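/- In the partition algebra A_k(z) (k ≥ 2): for every i with 1 ≤ i ≤ k−1 one has σ_{i+1} p_i p_{i+1/2} = s_i L_i p_{i+1/2} and σ_{i+1} p_{i+1} p_{i+1/2} = L_i p_{i+1/2}. -/

import Mathlib

open Polynomial

/-- Elements of an algebra over `R = ℤ[z]` (with `z = Polynomial.X`) satisfying the
defining relations of the partition algebra `A_k(z)` of Halverson–Ram.
Here `p i` stands for the generator `p_i` (for `1 ≤ i ≤ k`), `q i` stands for the
half-integer generator `p_{i+1/2}` (for `1 ≤ i ≤ k-1`), and `s i` stands for `s_i`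
(for `1 ≤ i ≤ k-1`). -/
structure PartitionAlgebra (k : ℕ) (A : Type*) [Ring A] [Algebra (Polynomial ℤ) A] where
  p : ℕ → A
  q : ℕ → A
  s : ℕ → A
  s_sq : ∀ i, 1 ≤ i → i ≤ k - 1 → s i * s i = 1
  s_comm : ∀ i j, 1 ≤ i → i ≤ k - 1 → 1 ≤ j → j ≤ k - 1 → j ≠ i + 1 → i ≠ j + 1 →
    s i * s j = s j * s i
  braid : ∀ i, 1 ≤ i → i + 1 ≤ k - 1 →
    s i * s (i + 1) * s i = s (i + 1) * s i * s (i + 1)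
  p_sq : ∀ i, 1 ≤ i → i ≤ k → p i * p i = (X : Polynomial ℤ) • p i
  q_sq : ∀ i, 1 ≤ i → i ≤ k - 1 → q i * q i = q i
  s_q : ∀ i, 1 ≤ i → i ≤ k - 1 → s i * q i = q i
  q_s : ∀ i, 1 ≤ i → i ≤ k - 1 → q i * s i = q i
  s_pp : ∀ i, 1 ≤ i → i ≤ k - 1 → s i * (p i * p (i + 1)) = p i * p (i + 1)
  pp_s : ∀ i, 1 ≤ i → i ≤ k - 1 → p i * p (i + 1) * s i = p i * p (i + 1)
  p_comm : ∀ i j, 1 ≤ i → i ≤ k → 1 ≤ j → j ≤ k → p i * p j = p j * p i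
  q_comm : ∀ i j, 1 ≤ i → i ≤ k - 1 → 1 ≤ j → j ≤ k - 1 → q i * q j = q j * q i
  q_p : ∀ i j, 1 ≤ i → i ≤ k - 1 → 1 ≤ j → j ≤ k → j ≠ i → j ≠ i + 1 →
    q i * p j = p j * q i
  s_p : ∀ i j, 1 ≤ i → i ≤ k - 1 → 1 ≤ j → j ≤ k → j ≠ i → j ≠ i + 1 →
    s i * p j = p j * s i
  s_q' : ∀ i j, 1 ≤ i → i ≤ k - 1 → 1 ≤ j → j ≤ k - 1 → j + 1 ≠ i → j ≠ i + 1 →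
    s i * q j = q j * s i
  sps : ∀ i, 1 ≤ i → i ≤ k - 1 → s i * p i * s i = p (i + 1)
  sqs : ∀ i, 2 ≤ i → i ≤ k - 1 →
    s i * q (i - 1) * s i = s (i - 1) * q i * s (i - 1)
  qpq₁ : ∀ i, 1 ≤ i → i ≤ k - 1 → q i * p i * q i = q i
  qpq₂ : ∀ i, 1 ≤ i → i ≤ k - 1 → q i * p (i + 1) * q i = q i
  pqp₁ : ∀ i, 2 ≤ i → i ≤ k → p i * q (i - 1) * p i = p i
  pqp₂ : ∀ i, 1 ≤ i → i ≤ k - 1 → p i * q i * p i = p i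

namespace PartitionAlgebra

variable {k : ℕ} {A : Type*} [Ring A] [Algebra (Polynomial ℤ) A]

/-- `(P.LS i).1 = L_i` and `(P.LS i).2 = σ_i` (with the junk value `σ_0 := 1`). -/
def LS (P : PartitionAlgebra k A) : ℕ → A × A
  | 0 => (0, 1)
  | 1 => (P.p 1, 1)
  | n + 2 =>
    let Lp := (P.LS (n + 1)).1
    let sp := (P.LS (n + 1)).2
    let Lpp := (P.LS n).1
    let snew : A :=
      if n = 0 then P.s 1
      else
        P.s n * P.s (n + 1) * sp * P.s (n + 1) * P.s n
          + P.s (n + 1) * P.q n * Lpp * P.s (n + 1) * P.q n * P.s (n + 1)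
          + P.q n * Lpp * P.s (n + 1) * P.q n
          - P.s (n + 1) * P.q n * Lpp * P.s n * P.q (n + 1) * P.p (n + 1) * P.q n
          - P.q n * P.p (n + 1) * P.q (n + 1) * P.s n * Lpp * P.q n * P.s (n + 1)
    (-(P.s (n + 1) * Lp * P.q (n + 1)) - P.q (n + 1) * Lp * P.s (n + 1)
        + P.q (n + 1) * Lp * P.p (n + 2) * P.q (n + 1)
        + P.s (n + 1) * Lp * P.s (n + 1) + snew,
      snew)

/-- The Jucys–Murphy element `L_i` of the partition algebra. -/
def L (P : PartitionAlgebra k A) (i : ℕ) : A := (P.LS i).1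

/-- The element `σ_i` of the partition algebra. -/
def sig (P : PartitionAlgebra k A) (i : ℕ) : A := (P.LS i).2

/-- `(P.LSh i).1 = L_{i+1/2}` and `(P.LSh i).2 = σ_{i+1/2}`. -/
def LSh (P : PartitionAlgebra k A) : ℕ → A × A
  | 0 => (0, 1)
  | 1 =>
    (-(P.L 1 * P.q 1) - P.q 1 * P.L 1 + P.q 1 * P.L 1 * P.p 1 * P.q 1
        + P.s 1 * (0 : A) * P.s 1 + 1, 1)
  | n + 2 =>
    let Lhp := (P.LSh (n + 1)).1
    let shp := (P.LSh (n + 1)).2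
    let snew : A :=
      P.s (n + 1) * P.s (n + 2) * shp * P.s (n + 2) * P.s (n + 1)
        + P.q (n + 1) * P.L (n + 1) * P.s (n + 2) * P.q (n + 1) * P.s (n + 2)
        + P.s (n + 2) * P.q (n + 1) * P.L (n + 1) * P.s (n + 2) * P.q (n + 1)
        - P.q (n + 1) * P.L (n + 1) * P.s (n + 1) * P.q (n + 2) * P.p (n + 2) * P.q (n + 1)
        - P.s (n + 2) * P.q (n + 1) * P.p (n + 2) * P.q (n + 2) * P.s (n + 1)
            * P.L (n + 1) * P.q (n + 1) * P.s (n + 2)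
    (-(P.L (n + 2) * P.q (n + 2)) - P.q (n + 2) * P.L (n + 2)
        + P.q (n + 2) * P.L (n + 2) * P.p (n + 2) * P.q (n + 2)
        + P.s (n + 2) * Lhp * P.s (n + 2) + snew,
      snew)

/-- The half-integer Jucys–Murphy element `L_{i+1/2}` of the partition algebra. -/
def Lh (P : PartitionAlgebra k A) (i : ℕ) : A := (P.LSh i).1

/-- The element `σ_{i+1/2}` of the partition algebra. -/
def sigH (P : PartitionAlgebra k A) (i : ℕ) : A := (P.LSh i).2

end PartitionAlgebra

namespace PartitionAlgebra

variable {k : ℕ} {A : Type*} [Ring A] [Algebra (Polynomial ℤ) A]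

/-- The same generators, viewed in the opposite algebra. -/
def op (P : PartitionAlgebra k A) : PartitionAlgebra k Aᵐᵒᵖ where
  p i := .op (P.p i)
  q i := .op (P.q i)
  s i := .op (P.s i)
  s_sq i h₁ h₂ := by simp only [← MulOpposite.op_mul, P.s_sq i h₁ h₂, MulOpposite.op_one]
  s_comm i j h₁ h₂ h₃ h₄ h₅ h₆ := by
    simp only [← MulOpposite.op_mul, P.s_comm i j h₁ h₂ h₃ h₄ h₅ h₆]
  braid i h₁ h₂ := by
    simp only [← MulOpposite.op_mul, ← mul_assoc, P.braid i h₁ h₂]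
  p_sq i h₁ h₂ := by simp only [← MulOpposite.op_mul, P.p_sq i h₁ h₂, MulOpposite.op_smul]
  q_sq i h₁ h₂ := by simp only [← MulOpposite.op_mul, P.q_sq i h₁ h₂]
  s_q i h₁ h₂ := by simp only [← MulOpposite.op_mul, P.q_s i h₁ h₂]
  q_s i h₁ h₂ := by simp only [← MulOpposite.op_mul, P.s_q i h₁ h₂]
  s_pp i h₁ h₂ := by
    simp only [← MulOpposite.op_mul]
    rw [P.p_comm (i + 1) i (by omega) (by omega) (by omega) (by omega), P.pp_s i h₁ h₂]
  pp_s i h₁ h₂ := by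
    simp only [← MulOpposite.op_mul]
    rw [P.p_comm (i + 1) i (by omega) (by omega) (by omega) (by omega), P.s_pp i h₁ h₂]
  p_comm i j h₁ h₂ h₃ h₄ := by simp only [← MulOpposite.op_mul, P.p_comm i j h₁ h₂ h₃ h₄]
  q_comm i j h₁ h₂ h₃ h₄ := by simp only [← MulOpposite.op_mul, P.q_comm i j h₁ h₂ h₃ h₄]
  q_p i j h₁ h₂ h₃ h₄ h₅ h₆ := by
    simp only [← MulOpposite.op_mul, P.q_p i j h₁ h₂ h₃ h₄ h₅ h₆]
  s_p i j h₁ h₂ h₃ h₄ h₅ h₆ := by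
    simp only [← MulOpposite.op_mul, P.s_p i j h₁ h₂ h₃ h₄ h₅ h₆]
  s_q' i j h₁ h₂ h₃ h₄ h₅ h₆ := by
    simp only [← MulOpposite.op_mul, P.s_q' i j h₁ h₂ h₃ h₄ h₅ h₆]
  sps i h₁ h₂ := by simp only [← MulOpposite.op_mul, ← mul_assoc, P.sps i h₁ h₂]
  sqs i h₁ h₂ := by simp only [← MulOpposite.op_mul, ← mul_assoc, P.sqs i h₁ h₂]
  qpq₁ i h₁ h₂ := by simp only [← MulOpposite.op_mul, ← mul_assoc, P.qpq₁ i h₁ h₂]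
  qpq₂ i h₁ h₂ := by simp only [← MulOpposite.op_mul, ← mul_assoc, P.qpq₂ i h₁ h₂]
  pqp₁ i h₁ h₂ := by simp only [← MulOpposite.op_mul, ← mul_assoc, P.pqp₁ i h₁ h₂]
  pqp₂ i h₁ h₂ := by simp only [← MulOpposite.op_mul, ← mul_assoc, P.pqp₂ i h₁ h₂]

variable (P : PartitionAlgebra k A)

lemma L_one : P.L 1 = P.p 1 := rfl

lemma sig_two : P.sig 2 = P.s 1 := rfl

lemma L_add_two (n : ℕ) :
    P.L (n + 2) = -(P.s (n + 1) * P.L (n + 1) * P.q (n + 1))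
      - P.q (n + 1) * P.L (n + 1) * P.s (n + 1)
      + P.q (n + 1) * P.L (n + 1) * P.p (n + 2) * P.q (n + 1)
      + P.s (n + 1) * P.L (n + 1) * P.s (n + 1) + P.sig (n + 2) := rfl

lemma L_succ {i : ℕ} (hi : 1 ≤ i) :
    P.L (i + 1) = -(P.s i * P.L i * P.q i) - P.q i * P.L i * P.s i
      + P.q i * P.L i * P.p (i + 1) * P.q i + P.s i * P.L i * P.s i + P.sig (i + 1) := by
  obtain ⟨n, rfl⟩ := Nat.exists_eq_add_of_le' hi
  exact P.L_add_two n

lemma sig_add_two {n : ℕ} (hn : n ≠ 0) :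
    P.sig (n + 2) = P.s n * P.s (n + 1) * P.sig (n + 1) * P.s (n + 1) * P.s n
      + P.s (n + 1) * P.q n * P.L n * P.s (n + 1) * P.q n * P.s (n + 1)
      + P.q n * P.L n * P.s (n + 1) * P.q n
      - P.s (n + 1) * P.q n * P.L n * P.s n * P.q (n + 1) * P.p (n + 1) * P.q n
      - P.q n * P.p (n + 1) * P.q (n + 1) * P.s n * P.L n * P.q n * P.s (n + 1) := by
  simp only [sig, LS, if_neg hn, L]

/-- An element commuting with the generators of `A_n` commutes with `L_n` and `σ_n`. -/
lemma commute_L_and_sig {x : A} (n : ℕ) (hp : ∀ j, 1 ≤ j → j ≤ n → Commute x (P.p j))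
    (hq : ∀ j, 1 ≤ j → j < n → Commute x (P.q j))
    (hs : ∀ j, 1 ≤ j → j < n → Commute x (P.s j)) :
    Commute x (P.L n) ∧ Commute x (P.sig n) := by
  induction n using Nat.strong_induction_on with
  | _ n ih =>
    match n with
    | 0 => exact ⟨Commute.zero_right x, Commute.one_right x⟩
    | 1 => exact ⟨hp 1 le_rfl le_rfl, Commute.one_right x⟩
    | n + 2 =>
      have restrict : ∀ m < n + 2, Commute x (P.L m) ∧ Commute x (P.sig m) := fun m hm =>
        ih m hm (fun j h₁ h₂ => hp j h₁ (by omega)) (fun j h₁ h₂ => hq j h₁ (by omega))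
          (fun j h₁ h₂ => hs j h₁ (by omega))
      obtain ⟨hL, hσ⟩ := restrict (n + 1) (by omega)
      have hL' := (restrict n (by omega)).1
      have hs₁ := hs (n + 1) (by omega) (by omega)
      have hq₁ := hq (n + 1) (by omega) (by omega)
      have hp₂ := hp (n + 2) (by omega) le_rfl
      have hσ₂ : Commute x (P.sig (n + 2)) := by
        rcases eq_or_ne n 0 with rfl | hn
        · exact hs₁
        have hs₀ := hs n (by omega) (by omega)
        have hq₀ := hq n (by omega) (by omega)
        have hp₁ := hp (n + 1) (by omega) (by omega)
        rw [P.sig_add_two hn]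
        refine (((Commute.add_right ?_ ?_).add_right ?_).sub_right ?_).sub_right ?_ <;>
        (repeat' refine Commute.mul_right ?_ ?_) <;> assumption
      refine ⟨?_, hσ₂⟩
      rw [P.L_add_two]
      refine (((Commute.sub_right (Commute.neg_right ?_) ?_).add_right ?_).add_right ?_).add_right
        hσ₂ <;>
      (repeat' refine Commute.mul_right ?_ ?_) <;> assumption

variable {P}

lemma commute_s_L {i n : ℕ} (hi : i ≤ k - 1) (hn : n < i) : Commute (P.s i) (P.L n) :=
  (P.commute_L_and_sig n
    (fun j h₁ h₂ => P.s_p i j (by omega) hi h₁ (by omega) (by omega) (by omega))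
    (fun j h₁ h₂ => P.s_q' i j (by omega) hi h₁ (by omega) (by omega) (by omega))
    (fun j h₁ h₂ => P.s_comm i j (by omega) hi h₁ (by omega) (by omega) (by omega))).1

lemma commute_s_sig {i n : ℕ} (hi : i ≤ k - 1) (hn : n < i) : Commute (P.s i) (P.sig n) :=
  (P.commute_L_and_sig n
    (fun j h₁ h₂ => P.s_p i j (by omega) hi h₁ (by omega) (by omega) (by omega))
    (fun j h₁ h₂ => P.s_q' i j (by omega) hi h₁ (by omega) (by omega) (by omega))
    (fun j h₁ h₂ => P.s_comm i j (by omega) hi h₁ (by omega) (by omega) (by omega))).2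

lemma commute_q_L {i n : ℕ} (hi : i ≤ k - 1) (hn : n < i) : Commute (P.q i) (P.L n) :=
  (P.commute_L_and_sig n
    (fun j h₁ h₂ => P.q_p i j (by omega) hi h₁ (by omega) (by omega) (by omega))
    (fun j h₁ h₂ => P.q_comm i j (by omega) hi h₁ (by omega))
    (fun j h₁ h₂ => (P.s_q' j i h₁ (by omega) (by omega) hi (by omega) (by omega)).symm)).1

lemma commute_p_L {i n : ℕ} (hi : i ≤ k) (hn : n < i) : Commute (P.p i) (P.L n) :=
  (P.commute_L_and_sig n
    (fun j h₁ h₂ => P.p_comm i j (by omega) hi h₁ (by omega))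
    (fun j h₁ h₂ => (P.q_p j i h₁ (by omega) (by omega) hi (by omega) (by omega)).symm)
    (fun j h₁ h₂ => (P.s_p j i h₁ (by omega) (by omega) hi (by omega) (by omega)).symm)).1

variable (P)

/-- `L_n` and `σ_n` are fixed by the anti-involution fixing the generators. -/
lemma op_L_and_sig (n : ℕ) (hk : n ≤ k) :
    P.op.L n = .op (P.L n) ∧ P.op.sig n = .op (P.sig n) := by
  induction n using Nat.strong_induction_on with
  | _ n ih =>
    match n with
    | 0 => exact ⟨rfl, rfl⟩
    | 1 => exact ⟨rfl, rfl⟩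
    | n + 2 =>
      have hσ : P.op.sig (n + 2) = .op (P.sig (n + 2)) := by
        rcases eq_or_ne n 0 with rfl | hn
        · rfl
        have hs : P.s (n + 1) * P.L n = P.L n * P.s (n + 1) :=
          commute_s_L (by omega) (by omega)
        have hs' (x : A) : P.s (n + 1) * (P.L n * x) = P.L n * (P.s (n + 1) * x) := by
          rw [← mul_assoc, hs, mul_assoc]
        rw [P.sig_add_two hn, P.op.sig_add_two hn, (ih n (by omega) (by omega)).1,
          (ih (n + 1) (by omega) (by omega)).2]
        simp only [op, ← MulOpposite.op_mul, ← MulOpposite.op_add, ← MulOpposite.op_sub]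
        congr 1
        simp only [mul_assoc, hs']
        abel
      have hp : P.p (n + 2) * (P.L (n + 1) * P.q (n + 1)) =
          P.L (n + 1) * (P.p (n + 2) * P.q (n + 1)) := by
        rw [← mul_assoc, commute_p_L hk (by omega), mul_assoc]
      refine ⟨?_, hσ⟩
      rw [P.L_add_two, P.op.L_add_two, hσ, (ih (n + 1) (by omega) (by omega)).1]
      simp only [op, ← MulOpposite.op_mul, ← MulOpposite.op_add, ← MulOpposite.op_sub,
        ← MulOpposite.op_neg]
      congr 1
      simp only [mul_assoc, hp]
      abel

variable {P}

lemma s_mul_p {i : ℕ} (h₁ : 1 ≤ i) (h₂ : i ≤ k - 1) : P.s i * P.p i = P.p (i + 1) * P.s i := by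
  rw [← P.sps i h₁ h₂, mul_assoc, P.s_sq i h₁ h₂, mul_one]

lemma s_mul_p_succ {i : ℕ} (h₁ : 1 ≤ i) (h₂ : i ≤ k - 1) :
    P.s i * P.p (i + 1) = P.p i * P.s i := by
  rw [← P.sps i h₁ h₂, ← mul_assoc, ← mul_assoc, P.s_sq i h₁ h₂, one_mul]

lemma p_mul_q_mul_p_succ {i : ℕ} (h₁ : 1 ≤ i) (h₂ : i ≤ k - 1) :
    P.p i * P.q i * P.p (i + 1) = P.p i * P.s i := by
  rw [← P.sps i h₁ h₂, ← mul_assoc, ← mul_assoc, mul_assoc (P.p i) (P.q i), P.q_s i h₁ h₂,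
    P.pqp₂ i h₁ h₂]

/-- The relations between `L_i`, `σ_{i+1}` and the generators that propagate by induction. -/
structure SigRelations (P : PartitionAlgebra k A) (i : ℕ) : Prop where
  s_sig : P.s i * P.sig (i + 1) = P.sig (i + 1) * P.s i
  q_sig : i + 1 ≤ k - 1 →
    P.q (i + 1) * (P.s i * P.sig (i + 1)) = P.s i * P.sig (i + 1) * P.q (i + 1)
  sig_p_q : P.sig (i + 1) * P.p (i + 1) * P.q i = P.L i * P.q i

lemma SigRelations.one (hk : 2 ≤ k) : P.SigRelations 1 where
  s_sig := rfl
  q_sig _ := by rw [P.sig_two, P.s_sq 1 le_rfl (by omega), mul_one, one_mul]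
  sig_p_q := by
    rw [P.sig_two, s_mul_p_succ le_rfl (by omega), mul_assoc, P.s_q 1 le_rfl (by omega), P.L_one]

lemma s_succ_mul_q_mul_s_succ {i : ℕ} (h₁ : 1 ≤ i) (h₂ : i + 1 ≤ k - 1) :
    P.s (i + 1) * P.q i * P.s (i + 1) = P.s i * P.q (i + 1) * P.s i := by
  simpa using P.sqs (i + 1) (by omega) h₂

lemma q_mul_L {i : ℕ} (h₁ : 1 ≤ i) (h₂ : i ≤ k - 1)
    (h : P.op.SigRelations i) : P.q i * P.L i = P.q i * P.p (i + 1) * P.sig (i + 1) := by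
  have := h.sig_p_q
  rw [(P.op_L_and_sig (i + 1) (by omega)).2, (P.op_L_and_sig i (by omega)).1] at this
  simpa [op, ← MulOpposite.op_mul, ← mul_assoc] using this.symm

/-- `p_{i+1/2} L_i s_i p_{i+3/2} p_{i+1} p_{i+1/2}` is fixed by the anti-involution. -/
lemma q_L_s_q_p_q {i : ℕ} (h₁ : 1 ≤ i) (h₂ : i + 1 ≤ k - 1)
    (h : P.SigRelations i) (h' : P.op.SigRelations i) :
    P.q i * P.L i * P.s i * P.q (i + 1) * P.p (i + 1) * P.q i =
      P.q i * P.p (i + 1) * P.q (i + 1) * P.s i * P.L i * P.q i := by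
  have e₁ := q_mul_L h₁ (by omega) h'
  have e₂ := h.q_sig h₂
  have e₃ := h.s_sig
  have e₄ := h.sig_p_q
  calc
    _ = P.q i * P.p (i + 1) * (P.s i * P.sig (i + 1) * P.q (i + 1)) * P.p (i + 1) * P.q i := by
      rw [e₁, e₃]; simp only [mul_assoc]
    _ = P.q i * P.p (i + 1) * P.q (i + 1) * P.s i * (P.sig (i + 1) * P.p (i + 1) * P.q i) := by
      rw [← e₂]; simp only [mul_assoc]
    _ = _ := by rw [e₄]; simp only [mul_assoc]

/-- The recursion for `s_i σ_{i+1}`, which is the element `σ_{i+1/2}`. -/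
lemma s_mul_sig_add_two {i : ℕ} (h₁ : 1 ≤ i) (h₂ : i + 1 ≤ k - 1) :
    P.s (i + 1) * P.sig (i + 2) =
      P.s i * P.s (i + 1) * (P.s i * P.sig (i + 1)) * P.s (i + 1) * P.s i
        + P.q i * P.L i * (P.s i * P.q (i + 1) * P.s i)
        + (P.s i * P.q (i + 1) * P.s i) * P.L i * P.q i
        - P.q i * P.L i * P.s i * P.q (i + 1) * P.p (i + 1) * P.q i
        - P.s i * P.q (i + 1) * P.p (i + 1) * P.q i * P.L i * (P.s i * P.q (i + 1) * P.s i) := by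
  have e₁ := s_succ_mul_q_mul_s_succ (P := P) h₁ h₂
  have e₂ := P.braid i h₁ h₂
  have e₃ := P.s_sq (i + 1) (by omega) h₂
  have e₄ : P.s (i + 1) * P.L i = P.L i * P.s (i + 1) := commute_s_L h₂ (by omega)
  have e₅ := s_mul_p (P := P) (i := i + 1) (by omega) h₂
  have e₆ := P.s_q (i + 1) (by omega) h₂
  have e₆' := P.q_s (i + 1) (by omega) h₂
  have e₇ := P.s_p i (i + 2) (by omega) (by omega) (by omega) (by omega) (by omega) (by omega)
  rw [P.sig_add_two (by omega)]
  generalize P.s i = sa, P.s (i + 1) = sb, P.q i = qa, P.q (i + 1) = qb, P.p (i + 1) = pb,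
    P.p (i + 1 + 1) = pc, P.L i = M, P.sig (i + 1) = t at *
  have f₁ : sb * qa * pb * qb * sa * M * qa * sb =
      sa * qb * pb * qa * M * (sa * qb * sa) := by
    linear_combination (norm := noncomm_ring)
      - sb * qa * e₃ * pb * qb * sa * M * qa * sb + e₁ * sb * pb * qb * sa * M * qa * sb
        + sa * qb * sa * e₅ * qb * sa * M * qa * sb + sa * qb * sa * pc * e₆ * sa * M * qa * sb
        + sa * qb * e₇ * qb * sa * M * qa * sb - sa * qb * pc * e₁ * M * qa * sb
        + sa * qb * pc * sb * qa * e₄ * qa * sb - sa * qb * e₅ * qa * M * sb * qa * sb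
        + sa * e₆' * pb * qa * M * sb * qa * sb + sa * qb * pb * qa * M * e₁
  linear_combination (norm := noncomm_ring)
    - e₂ * t * sb * sa + e₃ * qa * M * sb * qa * sb + qa * M * e₁ - sb * qa * e₄ * qa
      + e₁ * M * qa - e₃ * qa * M * sa * qb * pb * qa - f₁

lemma s_sig_succ {i : ℕ} (h₁ : 1 ≤ i) (h₂ : i + 1 ≤ k - 1)
    (h : P.SigRelations i) (h' : P.op.SigRelations i) :
    P.s (i + 1) * P.sig (i + 2) = P.sig (i + 2) * P.s (i + 1) := by
  have w := q_L_s_q_p_q h₁ h₂ h h'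
  have e₂ := P.braid i h₁ h₂
  have e₃ := P.s_sq (i + 1) (by omega) h₂
  have e₅ := h.s_sig
  rw [P.sig_add_two (by omega)]
  generalize P.s i = sa, P.s (i + 1) = sb, P.q i = qa, P.q (i + 1) = qb, P.p (i + 1) = pb,
    P.L i = M, P.sig (i + 1) = t at *
  linear_combination (norm := noncomm_ring)
    - e₂ * t * sb * sa + sa * sb * e₅ * sb * sa + sa * sb * t * e₂ + e₃ * qa * M * sb * qa * sb
      - sb * qa * M * sb * qa * e₃ - w + sb * w * sb - e₃ * qa * M * sa * qb * pb * qa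
      + qa * pb * qb * sa * M * qa * e₃

lemma q_sig_succ {i : ℕ} (h₁ : 1 ≤ i) (h₂ : i + 2 ≤ k - 1) (h : P.SigRelations i) :
    Commute (P.q (i + 2)) (P.s (i + 1) * P.sig (i + 2)) := by
  have cs : Commute (P.q (i + 2)) (P.s i) :=
    (P.s_q' i (i + 2) h₁ (by omega) (by omega) h₂ (by omega) (by omega)).symm
  have cqa : Commute (P.q (i + 2)) (P.q i) := P.q_comm _ _ (by omega) h₂ h₁ (by omega)
  have cqb : Commute (P.q (i + 2)) (P.q (i + 1)) := P.q_comm _ _ (by omega) h₂ (by omega) (by omega)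
  have cp : Commute (P.q (i + 2)) (P.p (i + 1)) :=
    P.q_p _ _ (by omega) h₂ (by omega) (by omega) (by omega) (by omega)
  have cL : Commute (P.q (i + 2)) (P.L i) := commute_q_L h₂ (by omega)
  have ct : Commute (P.q (i + 2))
      (P.s i * P.s (i + 1) * (P.s i * P.sig (i + 1)) * P.s (i + 1) * P.s i) := by
    have e₁ := s_succ_mul_q_mul_s_succ (P := P) (i := i + 1) (by omega) h₂
    have e₂ := P.s_sq (i + 1) (by omega) (by omega)
    have c : Commute (P.s (i + 2)) (P.s i * P.sig (i + 1)) :=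
      Commute.mul_right (P.s_comm _ _ (by omega) h₂ h₁ (by omega) (by omega) (by omega))
        (commute_s_sig h₂ (by omega))
    have c' : Commute (P.q (i + 1)) (P.s i * P.sig (i + 1)) := h.q_sig (by omega)
    have d : Commute (P.s (i + 2) * P.q (i + 1) * P.s (i + 2)) (P.s i * P.sig (i + 1)) :=
      (c.mul_left c').mul_left c
    have d' : Commute (P.q (i + 2)) (P.s (i + 1) * (P.s i * P.sig (i + 1)) * P.s (i + 1)) := by
      rw [e₁] at d
      unfold Commute SemiconjBy at *
      generalize P.s (i + 1) = sb, P.s i * P.sig (i + 1) = t, P.q (i + 2) = qc at *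
      have e (x : A) : sb * (sb * x) = x := by rw [← mul_assoc, e₂, one_mul]
      calc
        _ = sb * (sb * qc * sb * t) * sb := by simp only [mul_assoc, e]
        _ = _ := by rw [d]; simp only [mul_assoc, e₂, mul_one]
    simpa only [mul_assoc] using (cs.mul_right d').mul_right cs
  rw [s_mul_sig_add_two h₁ (by omega)]
  refine (((ct.add_right ?_).add_right ?_).sub_right ?_).sub_right ?_ <;>
  (repeat' refine Commute.mul_right ?_ ?_) <;> assumption

lemma sig_p_q_succ {i : ℕ} (h₁ : 1 ≤ i) (h₂ : i + 1 ≤ k - 1)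
    (h : P.SigRelations i) (h' : P.op.SigRelations i) :
    P.sig (i + 2) * P.p (i + 2) * P.q (i + 1) = P.L (i + 1) * P.q (i + 1) := by
  have w := q_L_s_q_p_q h₁ h₂ h h'
  have e₁ := s_succ_mul_q_mul_s_succ (P := P) h₁ h₂
  have r₁ := P.s_sq i h₁ (by omega)
  have r₂ := P.s_sq (i + 1) (by omega) h₂
  have r₃ := P.s_q (i + 1) (by omega) h₂
  have r₅ := P.q_comm i (i + 1) (by omega) (by omega) (by omega) h₂
  have r₆ : P.s i * P.p (i + 2) = P.p (i + 2) * P.s i :=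
    P.s_p _ _ (by omega) (by omega) (by omega) (by omega) (by omega) (by omega)
  have r₇ : P.q i * P.p (i + 2) = P.p (i + 2) * P.q i :=
    P.q_p _ _ (by omega) (by omega) (by omega) (by omega) (by omega) (by omega)
  have r₈ : P.s (i + 1) * P.p (i + 2) = P.p (i + 1) * P.s (i + 1) := s_mul_p_succ (by omega) h₂
  have r₉ : P.p (i + 1) * P.q (i + 1) * P.p (i + 2) = P.p (i + 1) * P.s (i + 1) :=
    p_mul_q_mul_p_succ (by omega) h₂
  have r₁₀ : P.p i * P.q i * P.p (i + 1) = P.p i * P.s i := p_mul_q_mul_p_succ h₁ (by omega)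
  have r₁₂ : P.q (i + 1) * P.p (i + 2) * P.q (i + 1) = P.q (i + 1) := P.qpq₂ _ (by omega) h₂
  have m₁ : P.s (i + 1) * P.L i = P.L i * P.s (i + 1) := commute_s_L h₂ (by omega)
  have m₂ : P.q (i + 1) * P.L i = P.L i * P.q (i + 1) := commute_q_L h₂ (by omega)
  have m₄ : P.p (i + 2) * P.L i = P.L i * P.p (i + 2) := commute_p_L (by omega) (by omega)
  have t₂ := h.s_sig
  have t₃ := h.q_sig h₂
  have t₄ := h.sig_p_q
  have r₁₄ : P.s i * P.p (i + 1) = P.p i * P.s i := s_mul_p_succ h₁ (by omega)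
  have r₁₅ := P.qpq₁ (i + 1) (by omega) h₂
  have r₁₆ : P.p (i + 1) * P.q i * P.p (i + 1) = P.p (i + 1) := P.pqp₁ _ (by omega) (by omega)
  have r₁₇ := P.s_q i h₁ (by omega)
  rw [P.sig_add_two (by omega), P.L_succ h₁]
  generalize P.s i = sa, P.s (i + 1) = sb, P.q i = qa, P.q (i + 1) = qb, P.p i = pa,
    P.p (i + 1) = pb, P.p (i + 2) = pc, P.L i = M, P.sig (i + 1) = t at *
  have u : sb * sa * qb = qa * sb * sa := by
    linear_combination (norm := noncomm_ring)
      r₂ * qa * sb * sa - sb * e₁ * sa - sb * sa * qb * r₁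
  have v : sa * M * qa = t * pa * qa := by
    linear_combination (norm := noncomm_ring)
      - sa * t₄ + t₂ * pb * qa + t * r₁₄ * qa + t * pa * r₁₇
  have f₁ : sa * sb * t * sb * sa * pc * qb = sa * M * sa * qb := by
    linear_combination (norm := noncomm_ring)
      sa * sb * t * sb * r₆ * qb + sa * sb * t * r₈ * sa * qb + sa * sb * t * pb * u
        + sa * sb * t₄ * sb * sa + sa * m₁ * qa * sb * sa + sa * M * e₁ * sa
        + sa * M * sa * qb * r₁
  have f₂ : sb * qa * M * sb * qa * sb * pc * qb = t * qb := by
    linear_combination (norm := noncomm_ring)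
      sb * qa * M * sb * qa * r₈ * qb + sb * qa * M * sb * qa * pb * r₃
        - sb * qa * m₁ * qa * pb * qb + e₁ * M * qa * pb * qb + sa * qb * v * pb * qb
        + sa * qb * t * r₁₀ * qb - sa * qb * t * r₁₄ * qb - sa * qb * t₂ * pb * qb
        + sa * t₃ * pb * qb + r₁ * t * qb * pb * qb + t * r₁₅
  have f₃ : qa * M * sb * qa * pc * qb = qa * M * pb * qa * qb := by
    linear_combination (norm := noncomm_ring)
      qa * M * sb * r₇ * qb + qa * M * r₈ * qa * qb + qa * M * pb * sb * r₅
        + qa * M * pb * r₃ * qa - qa * M * pb * r₅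
  have f₄ : sb * qa * M * sa * qb * pb * qa * pc * qb = sa * M * qa * qb := by
    linear_combination (norm := noncomm_ring)
      sb * w * pc * qb + sb * qa * pb * qb * sa * M * r₇ * qb
        - sb * qa * pb * qb * sa * m₄ * qa * qb + sb * qa * pb * qb * r₆ * M * qa * qb
        + sb * qa * r₉ * sa * M * qa * qb - sb * qa * r₈ * sa * M * qa * qb
        + e₁ * pc * sa * M * qa * qb + sa * qb * r₆ * sa * M * qa * qb
        + sa * qb * pc * r₁ * M * qa * qb + sa * qb * m₄ * qa * qb + sa * m₂ * pc * qa * qb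
        + sa * M * qb * pc * r₅ + sa * M * r₁₂ * qa - sa * M * r₅
  have f₅ : qa * pb * qb * sa * M * qa * sb * pc * qb = qa * M * sa * qb := by
    linear_combination (norm := noncomm_ring)
      qa * pb * qb * sa * M * qa * r₈ * qb + qa * pb * qb * sa * M * qa * pb * r₃
        - w * pb * qb + qa * M * sa * qb * r₁₆ * qb + qa * M * sa * r₁₅
  linear_combination (norm := noncomm_ring) f₁ + f₂ + f₃ - f₄ - f₅

lemma sigRelations (P : PartitionAlgebra k A) {i : ℕ} (h₁ : 1 ≤ i) (h₂ : i ≤ k - 1) :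
    P.SigRelations i := by
  induction i, h₁ using Nat.le_induction generalizing A with
  | base => exact .one (by omega)
  | succ i h₁ ih =>
    have h := ih P (by omega)
    have h' := ih P.op (by omega)
    exact ⟨s_sig_succ h₁ h₂ h h', fun h₃ => q_sig_succ h₁ h₃ h, sig_p_q_succ h₁ h₂ h h'⟩

end PartitionAlgebra

/-- Proposition 3.2(3)–(4): `σ_{i+1} p_i p_{i+1/2} = s_i L_i p_{i+1/2}` and
`σ_{i+1} p_{i+1} p_{i+1/2} = L_i p_{i+1/2}` for `1 ≤ i ≤ k-1`. -/
theorem partitionAlgebra_sig_p_q {k : ℕ} (hk : 2 ≤ k) {A : Type*} [Ring A]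
    [Algebra (Polynomial ℤ) A] (P : PartitionAlgebra k A) :
    ∀ i, 1 ≤ i → i ≤ k - 1 →
      P.sig (i + 1) * P.p i * P.q i = P.s i * P.L i * P.q i ∧
      P.sig (i + 1) * P.p (i + 1) * P.q i = P.L i * P.q i := by
  intro i h₁ h₂
  have h := P.sigRelations h₁ h₂
  refine ⟨?_, h.sig_p_q⟩
  calc
    _ = P.sig (i + 1) * (P.p i * P.s i) * P.q i := by
      simp only [mul_assoc, P.s_q i h₁ h₂]
    _ = P.s i * (P.sig (i + 1) * P.p (i + 1) * P.q i) := by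
      rw [← PartitionAlgebra.s_mul_p_succ h₁ h₂, ← mul_assoc, ← h.s_sig]
      simp only [mul_assoc]
    _ = _ := by rw [h.sig_p_q, mul_assoc]
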